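/- arXiv:1806.10053 — 3 statements merged into one kernel-verified Lean document; each statement's English description precedes it below -/
import Mathlib

section
/- The multiple zeta star value ζ*({2}^a, 1, {2}^b, 3, {2}^c), summed over all 6 permutations of the triple (a+1, b, c) placed in the three positions of repeated 2's (with the first block always incremented by 1), equals ζ*({2}^{a+1})·ζ*({2}^{b+1})·ζ*({2}^{c+1}) + 2·ζ*({2}^{a+b+c+3}), for all nonnegative integers a, b, c. -/
open Finset

/-- The multiple zeta star value `ζ⋆(s₁,…,s_r) = ∑_{0 < n₁ ≤ ⋯ ≤ n_r} 1/(n₁^{s₁}⋯n_r^{s_r})`. -/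
noncomputable def zetaStar (s : List ℕ) : ℝ :=
  ∑' f : {f : Fin s.length → ℕ+ // Monotone f},
    ∏ i, ((f.1 i : ℝ) ^ s.get i)⁻¹

open Filter Topology

noncomputable def RR : List ℕ → ℕ+ → ℕ+ → ℝ
  | [], _, _ => 1
  | x :: t, lo, n => ∑ m ∈ Finset.Icc lo n, ((m : ℝ) ^ x)⁻¹ * RR t m n

open Classical in
noncomputable def FF (r : ℕ) (lo n : ℕ+) : Finset (Fin r → ℕ+) :=
  (Fintype.piFinset fun _ : Fin r => Finset.Icc lo n).filter Monotone

lemma mem_FF {r : ℕ} {lo n : ℕ+} {f : Fin r → ℕ+} :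
    f ∈ FF r lo n ↔ (∀ i, lo ≤ f i ∧ f i ≤ n) ∧ Monotone f := by
  simp [FF, Fintype.mem_piFinset]

lemma mono_cons {r : ℕ} (m : ℕ+) (g : Fin r → ℕ+) :
    Monotone (Fin.cons m g : Fin (r+1) → ℕ+) ↔ (∀ i, m ≤ g i) ∧ Monotone g := by
  constructor
  · intro h
    refine ⟨fun i => ?_, fun i j hij => ?_⟩
    · simpa using h (Fin.zero_le i.succ)
    · simpa using h (Fin.succ_le_succ_iff.mpr hij)
  · rintro ⟨h1, h2⟩ i j hij
    induction i using Fin.cases with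
    | zero =>
      induction j using Fin.cases with
      | zero => simp
      | succ j => simpa using h1 j
    | succ i =>
      induction j using Fin.cases with
      | zero => exact absurd hij (by simp)
      | succ j => simpa using h2 (Fin.succ_le_succ_iff.mp hij)

lemma RR_eq (s : List ℕ) (lo n : ℕ+) :
    RR s lo n = ∑ f ∈ FF s.length lo n, ∏ i, ((f i : ℝ) ^ s.get i)⁻¹ := by
  induction s generalizing lo with
  | nil =>
    have : FF ([] : List ℕ).length lo n = {Fin.elim0} := by
      ext f
      rw [mem_FF]
      simp only [Finset.mem_singleton]
      constructor
      · intro _; funext i; exact i.elim0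
      · intro _; exact ⟨fun i => i.elim0, fun i => i.elim0⟩
    rw [this]
    simp [RR]
  | cons x t ih =>
    simp only [RR, ih, Finset.mul_sum]
    rw [Finset.sum_sigma']
    refine Finset.sum_bij' (fun p _ => (Fin.cons p.1 p.2 : Fin (t.length+1) → ℕ+))
      (fun f _ => ⟨f 0, Fin.tail f⟩) ?_ ?_ ?_ ?_ ?_
    · rintro ⟨m, g⟩ h
      simp only [Finset.mem_sigma, Finset.mem_Icc, mem_FF] at h
      refine mem_FF.mpr ⟨fun i => ?_, (mono_cons _ _).mpr ⟨fun i => (h.2.1 i).1, h.2.2⟩⟩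
      induction i using Fin.cases with
      | zero => simpa using h.1
      | succ i => simpa using ⟨h.1.1.trans (h.2.1 i).1, (h.2.1 i).2⟩
    · intro f h
      have h := mem_FF.mp h
      have h2 := h.2
      rw [← Fin.cons_self_tail (n := t.length) f, mono_cons] at h2
      simp only [Finset.mem_sigma, Finset.mem_Icc, mem_FF]
      exact ⟨h.1 _, fun i => ⟨h2.1 i, (h.1 i.succ).2⟩, h2.2⟩
    · rintro ⟨m, g⟩ h
      simp
    · intro f h
      exact Fin.cons_self_tail (n := t.length) f
    · rintro ⟨m, g⟩ h
      exact (Fin.prod_univ_succ (n := t.length) (fun i : Fin (t.length+1) =>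
        ((((Fin.cons m g : Fin (t.length+1) → ℕ+) i : ℕ+) : ℝ) ^ (x :: t).get i)⁻¹)).symm

lemma RR_snoc (t : List ℕ) (x : ℕ) (lo n : ℕ+) :
    RR (t ++ [x]) lo n = ∑ m ∈ Finset.Icc lo n, ((m : ℝ) ^ x)⁻¹ * RR t lo m := by
  induction t generalizing lo with
  | nil => simp [RR]
  | cons y t ih =>
    simp only [List.cons_append, RR, ih, Finset.mul_sum]
    rw [Finset.sum_sigma', Finset.sum_sigma']
    refine Finset.sum_bij' (fun p _ => ⟨p.2, p.1⟩) (fun p _ => ⟨p.2, p.1⟩) ?_ ?_ ?_ ?_ ?_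
    · rintro ⟨p, q⟩ h
      simp only [Finset.mem_sigma, Finset.mem_Icc] at h ⊢
      exact ⟨⟨h.1.1.trans h.2.1, h.2.2⟩, h.1.1, h.2.1⟩
    · rintro ⟨p, q⟩ h
      simp only [Finset.mem_sigma, Finset.mem_Icc] at h ⊢
      exact ⟨⟨h.2.1, h.2.2.trans h.1.2⟩, h.2.2, h.1.2⟩
    · intro _ _; rfl
    · intro _ _; rfl
    · rintro ⟨p, q⟩ h
      simp only
      ring

lemma sum_pnat (n : ℕ) (g : ℕ+ → ℝ) :
    ∑ m ∈ Finset.Icc 1 n.succPNat, g m = ∑ m ∈ Finset.range (n+1), g m.succPNat := by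
  refine Finset.sum_bij' (fun m _ => m.natPred) (fun m _ => m.succPNat) ?_ ?_ ?_ ?_ ?_
  · intro m h
    have h := (Finset.mem_Icc.mp h).2
    have : (m : ℕ) ≤ n + 1 := h
    have h3 := PNat.natPred_add_one m
    rw [Finset.mem_range]; omega
  · intro m h
    rw [Finset.mem_range] at h
    exact Finset.mem_Icc.mpr ⟨one_le, by
      rw [← PNat.coe_le_coe]; simp only [Nat.succPNat_coe]; omega⟩
  · intro m _; simp
  · intro m _; simp
  · intro m _; simp

lemma zetaStar_of_tendsto (s : List ℕ) (L : ℝ)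
    (h : Tendsto (fun n : ℕ => RR s 1 n.succPNat) atTop (𝓝 L)) : zetaStar s = L := by
  classical
  set F : {f : Fin s.length → ℕ+ // Monotone f} → ℝ := fun f => ∏ i, ((f.1 i : ℝ) ^ s.get i)⁻¹
    with hF
  have hF0 : ∀ f, 0 ≤ F f := fun f => Finset.prod_nonneg fun i _ => by positivity
  let G : ℕ → Finset {f : Fin s.length → ℕ+ // Monotone f} :=
    fun n => (FF s.length 1 n.succPNat).subtype Monotone
  have hG : ∀ n, ∑ f ∈ G n, F f = RR s 1 n.succPNat := by
    intro n
    rw [RR_eq]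
    have := Finset.sum_subtype_of_mem (s := FF s.length 1 n.succPNat) (p := Monotone)
      (fun f : Fin s.length → ℕ+ => ∏ i, ((f i : ℝ) ^ s.get i)⁻¹)
      (fun f hf => (mem_FF.mp hf).2)
    exact this
  have hmono : Monotone G := by
    intro m n hmn f hf
    simp only [G, Finset.mem_subtype, mem_FF] at hf ⊢
    refine ⟨fun i => ⟨(hf.1 i).1, (hf.1 i).2.trans ?_⟩, hf.2⟩
    exact Nat.succPNat_le_succPNat.mpr hmn
  have hex : ∀ f, ∃ n, f ∈ G n := by
    intro f
    refine ⟨∑ i, (f.1 i : ℕ), ?_⟩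
    simp only [G, Finset.mem_subtype, mem_FF]
    refine ⟨fun i => ⟨one_le, ?_⟩, f.2⟩
    rw [← PNat.coe_le_coe, Nat.succPNat_coe]
    exact (Finset.single_le_sum (f := fun i => (f.1 i : ℕ)) (fun _ _ => Nat.zero_le _)
      (Finset.mem_univ i)).trans (Nat.le_succ _)
  have hGt : Tendsto G atTop atTop := tendsto_atTop_finset_of_monotone hmono hex
  have hmR : Monotone (fun n => ∑ f ∈ G n, F f) := fun m n hmn =>
    Finset.sum_le_sum_of_subset_of_nonneg (hmono hmn) fun f _ _ => hF0 f
  simp only [← hG] at h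
  have hle : ∀ n, ∑ f ∈ G n, F f ≤ L := fun n => hmR.ge_of_tendsto h n
  have hs : Summable F := by
    refine summable_of_sum_le hF0 (c := L) fun u => ?_
    obtain ⟨n, hn⟩ := (hGt.eventually (eventually_ge_atTop u)).exists
    exact (Finset.sum_le_sum_of_subset_of_nonneg hn fun f _ _ => hF0 f).trans (hle n)
  exact tendsto_nhds_unique (hs.hasSum.comp hGt) h

/-- connector -/
noncomputable def cc (n : ℝ) (K : ℕ) : ℝ := ∏ i ∈ Finset.range K, ((n - i) / (n + i + 1))

lemma cc_succ {n : ℝ} (hn : 0 ≤ n) (K : ℕ) : cc n (K+1) * (n + K + 1) = cc n K * (n - K) := by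
  have : n + K + 1 ≠ 0 := by positivity
  rw [cc, Finset.prod_range_succ, ← cc]
  field_simp

lemma cc_n {n : ℝ} (hn : 0 ≤ n) (K : ℕ) :
    cc n K * (n+1)^2 = cc (n+1) K * ((n+1)^2 - K^2) := by
  induction K with
  | zero => simp [cc]
  | succ K ih =>
    have h1 := cc_succ hn K
    have h2 := cc_succ (n := n+1) (by positivity) K
    have e1 : n + K + 1 ≠ 0 := by positivity
    have e2 : n + K + 2 ≠ 0 := by positivity
    apply mul_right_cancel₀ e1
    push_cast
    calc cc n (K+1) * (n+1)^2 * (n+K+1) = (cc n (K+1) * (n+K+1)) * (n+1)^2 := by ring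
      _ = (cc n K * (n+1)^2) * (n-K) := by rw [h1]; ring
      _ = (cc (n+1) K * (n + 1 - K)) * ((n+1+K) * (n-K)) := by rw [ih]; ring
      _ = _ := by rw [← h2]; ring

lemma cc_zero {n K : ℕ} (h : n < K) : cc n K = 0 := by
  rw [cc]
  exact Finset.prod_eq_zero (Finset.mem_range.mpr h) (by simp)

lemma cc_abs (n K : ℕ) : |cc n K| ≤ 1 := by
  rcases lt_or_ge n K with h | h
  · simp [cc_zero h]
  · rw [cc, Finset.abs_prod]
    apply Finset.prod_le_one
    · intros; positivity
    · intro i hi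
      have : (i:ℝ) ≤ n := by exact_mod_cast (Finset.mem_range.mp hi).le.trans h
      rw [abs_of_nonneg (div_nonneg (by linarith) (by positivity)), div_le_one (by positivity)]
      have : (0:ℝ) ≤ i := by positivity
      linarith

lemma cc_tendsto (K : ℕ) : Tendsto (fun n : ℕ => cc ((n+1 : ℕ) : ℝ) K) atTop (𝓝 1) := by
  unfold cc
  suffices key : Tendsto (fun n : ℕ => ∏ i ∈ Finset.range K,
      ((((n+1 : ℕ) : ℝ) - i) / (((n+1 : ℕ) : ℝ) + i + 1))) atTop
      (𝓝 (∏ i ∈ Finset.range K, (1:ℝ))) by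
    rwa [Finset.prod_const_one] at key
  refine tendsto_finsetProd _ fun i _ => ?_
  have h : ∀ n : ℕ, (((n+1:ℕ):ℝ) - i) / (((n+1:ℕ):ℝ) + i + 1)
      = 1 - (2*i+1) / ((n:ℝ) + ((i:ℝ) + 2)) := by
    intro n
    push_cast
    have : (n:ℝ) + 1 + i + 1 ≠ 0 := by positivity
    have : (n:ℝ) + (i + 2) ≠ 0 := by positivity
    field_simp
    ring
  refine Tendsto.congr (fun n => (h n).symm) ?_
  have h2 : Tendsto (fun n : ℕ => (n:ℝ) + ((i:ℝ)+2)) atTop atTop :=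
    tendsto_atTop_add_const_right _ _ tendsto_natCast_atTop_atTop
  simpa using (tendsto_const_nhds (x := (1:ℝ))).sub (h2.const_div_atTop (2*(i:ℝ)+1))

noncomputable def TT (n : ℕ) (A : ℕ → ℝ) : ℝ := ∑ k ∈ Finset.range n, cc n (k+1) * A k

def MRep (t : List ℕ) (A : ℕ → ℝ) : Prop := ∀ n : ℕ, RR t 1 n.succPNat = TT (n+1) A

lemma MRep_congr {t t' : List ℕ} {A B : ℕ → ℝ} (h : MRep t A) (ht : t = t')
    (hAB : ∀ k, A k = B k) : MRep t' B := by
  subst ht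
  have : A = B := funext hAB
  exact this ▸ h

lemma TT_diff (n : ℕ) (B : ℕ → ℝ) :
    TT (n+1) B = TT n B + ((n+1:ℝ)^2)⁻¹ * TT (n+1) (fun k => (k+1:ℝ)^2 * B k) := by
  have h0 : TT n B = ∑ k ∈ Finset.range (n+1), cc n (k+1) * B k := by
    rw [Finset.sum_range_succ, cc_zero (Nat.lt_succ_self n)]; simp [TT]
  rw [h0]
  simp only [TT]
  rw [Finset.mul_sum, ← Finset.sum_add_distrib]
  refine Finset.sum_congr rfl fun k _ => ?_
  have h := cc_n (n := n) (by positivity) (k+1)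
  have e : (n+1:ℝ) ≠ 0 := by positivity
  have h' : cc n (k+1) = cc ((n:ℝ)+1) (k+1) * ((n+1)^2 - (k+1)^2) / (n+1)^2 := by
    rw [eq_div_iff (by positivity)]; push_cast at h; linarith
  push_cast
  rw [h']
  field_simp
  ring

lemma MRep_step {t : List ℕ} {A B : ℕ → ℝ} (x : ℕ) (h : MRep t A)
    (hB : ∀ n : ℕ, ((n+1:ℝ)^2)⁻¹ * TT (n+1) (fun k => (k+1:ℝ)^2 * B k)
      = ((n+1:ℝ)^x)⁻¹ * TT (n+1) A) : MRep (t ++ [x]) B := by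
  intro n
  rw [RR_snoc, sum_pnat]
  induction n with
  | zero =>
    rw [TT_diff, hB]
    simp [h 0, TT]
  | succ n ih =>
    rw [Finset.sum_range_succ, ih, TT_diff (n+1), hB, h (n+1)]
    push_cast
    simp

lemma MRep_two {t : List ℕ} {A : ℕ → ℝ} (h : MRep t A) :
    MRep (t ++ [2]) (fun k => ((k+1:ℝ)^2)⁻¹ * A k) := by
  refine MRep_step 2 h fun n => ?_
  congr 2
  funext k
  have : (k+1:ℝ) ≠ 0 := by positivity
  field_simp

lemma MRep_twos {t : List ℕ} {A : ℕ → ℝ} (h : MRep t A) (m : ℕ) :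
    MRep (t ++ List.replicate m 2) (fun k => ((k+1:ℝ)^(2*m))⁻¹ * A k) := by
  induction m with
  | zero => simpa using h
  | succ m ih =>
    rw [List.replicate_succ', ← List.append_assoc]
    convert MRep_two ih using 2 with k
    have : (k+1:ℝ) ≠ 0 := by positivity
    field_simp
    ring

lemma MRep_nil : MRep [] (fun k => 2 * (-1)^k) := by
  intro n
  have key : ∀ N : ℕ, ∑ k ∈ Finset.range N, cc ((n+1:ℕ):ℝ) (k+1) * (2 * (-1)^k) * (n+1)
      = (n+1) - (-1)^N * cc ((n+1:ℕ):ℝ) (N+1) * (n+1+N+1) := by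
    intro N
    have h0 := cc_succ (n := ((n+1:ℕ):ℝ)) (by positivity) N
    induction N with
    | zero => simp [cc] at h0 ⊢; field_simp; ring
    | succ N ih =>
      have h1 := cc_succ (n := ((n+1:ℕ):ℝ)) (by positivity) N
      rw [Finset.sum_range_succ, ih h1]
      push_cast at h0 h1 ⊢
      have : cc (↑n + 1) (N + 1 + 1) * (n + 1 + (N+1) + 1) = cc (↑n + 1) (N + 1) * (n+1-(N+1)) := h0
      rw [mul_assoc ((-1)^(N+1)) _ _, this]
      ring
  have k := key (n+1)
  rw [cc_zero (Nat.lt_succ_self (n+1)), ← Finset.sum_mul] at k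
  have e : (n+1:ℝ) ≠ 0 := by positivity
  simp only [RR, TT]
  apply mul_right_cancel₀ e
  rw [k]; ring

noncomputable def PP (f : ℕ → ℝ) (j : ℕ) : ℝ := f j + 2 * ∑ k ∈ Finset.range j, f k

lemma PP_succ (f : ℕ → ℝ) (j : ℕ) : PP f (j+1) = PP f j + f j + f (j+1) := by
  simp only [PP, Finset.sum_range_succ]; ring

lemma cc_n_mul (n : ℕ) (A : ℕ → ℝ) :
    (n:ℝ) * TT n A = TT n (fun j => (j+1) * PP A j) := by
  -- generic partial sum identity
  have key : ∀ N : ℕ, ∑ j ∈ Finset.range N, cc n (j+1) * ((j+1) * PP A j)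
      = n * ∑ k ∈ Finset.range N, cc n (k+1) * A k
        - (n + N + 1) * cc n (N+1) * (∑ k ∈ Finset.range N, A k)
        + (N+1) * cc n (N+1) * 0 - (n - N) * cc n N * 0 - 0 := by
    intro N
    induction N with
    | zero => simp
    | succ N ih =>
      have h := cc_succ (n := (n:ℝ)) (by positivity) (N+1)
      rw [Finset.sum_range_succ, ih]
      simp only [PP, Finset.sum_range_succ]
      push_cast at h ⊢
      have h' : (n + (N+1) + 1 : ℝ) * cc n (N+1+1) = cc n (N+1) * (n - (N+1)) := by linarith
      rw [h']
      ring
  have k := key n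
  rw [cc_zero (Nat.lt_succ_self n)] at k
  simp only [TT]
  rw [k]; ring

lemma MRep_one {t : List ℕ} {A : ℕ → ℝ} (h : MRep t A) :
    MRep (t ++ [1]) (fun k => (k+1:ℝ)⁻¹ * PP A k) := by
  refine MRep_step 1 h fun n => ?_
  have h2 := cc_n_mul (n+1) A
  have : (fun k : ℕ => (k+1:ℝ)^2 * ((k+1:ℝ)⁻¹ * PP A k)) = fun j : ℕ => (j+1:ℝ) * PP A j := by
    funext k
    have : (k+1:ℝ) ≠ 0 := by positivity
    field_simp
  rw [this, ← h2]
  have : (n+1:ℝ) ≠ 0 := by positivity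
  push_cast
  field_simp

lemma PP_inv (D : ℕ → ℝ) (j : ℕ) :
    PP (fun l => (-1)^l * PP (fun i => (-1)^i * D i) l) j = D j := by
  induction j with
  | zero => simp [PP]
  | succ j ih =>
    rw [PP_succ, ih, PP_succ (fun i => (-1)^i * D i)]
    have : ((-1:ℝ)^j)^2 = 1 := by rw [← pow_mul, mul_comm, pow_mul]; simp
    rw [pow_succ]
    linear_combination (D (j+1) - D j) * this

lemma MRep_three {t : List ℕ} {A : ℕ → ℝ} (h : MRep t A) :
    MRep (t ++ [3]) (fun k => ((k+1:ℝ)^2)⁻¹ *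
      ((-1)^k * PP (fun i => (-1)^i * ((i+1:ℝ)⁻¹ * A i)) k)) := by
  refine MRep_step 3 h fun n => ?_
  set C : ℕ → ℝ := fun k => (-1)^k * PP (fun i => (-1)^i * ((i+1:ℝ)⁻¹ * A i)) k with hC
  have h1 : (fun k : ℕ => (k+1:ℝ)^2 * (((k+1:ℝ)^2)⁻¹ * C k)) = C := by
    funext k
    have : (k+1:ℝ) ≠ 0 := by positivity
    field_simp
  have h2 := cc_n_mul (n+1) C
  have h3 : (fun j : ℕ => (j+1:ℝ) * PP C j) = A := by
    funext j
    rw [hC, PP_inv (fun i : ℕ => (i+1:ℝ)⁻¹ * A i)]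
    have : (j+1:ℝ) ≠ 0 := by positivity
    field_simp
  change ((n+1:ℝ)^2)⁻¹ * TT (n+1) (fun k : ℕ => (k+1:ℝ)^2 * (((k+1:ℝ)^2)⁻¹ * C k)) = _
  rw [h1]
  rw [h3] at h2
  rw [← h2]
  have : (n+1:ℝ) ≠ 0 := by positivity
  push_cast
  field_simp

lemma MRep_lim {t : List ℕ} {A : ℕ → ℝ} (h : MRep t A) (hA : Summable A) :
    Tendsto (fun N => ∑ k ∈ Finset.range N, A k) atTop (𝓝 (zetaStar t)) := by
  have : zetaStar t = ∑' k, A k := by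
    apply zetaStar_of_tendsto
    have e : ∀ n : ℕ, RR t 1 n.succPNat = ∑' k, cc ((n+1:ℕ):ℝ) (k+1) * A k := by
      intro n
      rw [h n, TT, tsum_eq_sum]
      intro k hk
      rw [cc_zero, zero_mul]
      simp at hk; omega
    simp only [e]
    refine tendsto_tsum_of_dominated_convergence (bound := fun k => |A k|) hA.abs ?_ ?_
    · intro k
      simpa using (cc_tendsto (k+1)).mul_const (A k)
    · refine Eventually.of_forall fun n k => ?_
      rw [Real.norm_eq_abs, abs_mul]
      exact mul_le_of_le_one_left (abs_nonneg _) (cc_abs _ _)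
  rw [this]
  exact hA.hasSum.tendsto_sum_nat

noncomputable def uu (a : ℕ) (k : ℕ) : ℝ := (-1)^k * ((k+1:ℝ)^(2*(a+1)))⁻¹

lemma uu_summable (a : ℕ) : Summable (uu a) := by
  apply Summable.of_norm
  have h : Summable (fun k : ℕ => ((((k+1:ℕ):ℝ))^(2*(a+1)))⁻¹) :=
    (summable_nat_add_iff 1).mpr (Real.summable_nat_pow_inv.mpr (by omega))
  refine h.congr fun k => ?_
  simp only [uu, norm_mul, norm_pow, norm_neg, norm_one, one_pow, one_mul, Real.norm_eq_abs]
  push_cast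
  rw [abs_of_nonneg (by positivity)]

lemma uPP_summable (a : ℕ) {f : ℕ → ℝ} (hf : Summable f) :
    Summable (fun k => uu a k * PP f k) := by
  have hb : ∀ k, |PP f k| ≤ 3 * ∑' i, |f i| := by
    intro k
    have h1 : |f k| ≤ ∑' i, |f i| := hf.abs.le_tsum k fun _ _ => abs_nonneg _
    have h2 : |∑ i ∈ Finset.range k, f i| ≤ ∑' i, |f i| :=
      (Finset.abs_sum_le_sum_abs _ _).trans (hf.abs.sum_le_tsum _ fun _ _ => abs_nonneg _)
    rw [PP]
    refine (abs_add_le _ _).trans ?_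
    rw [abs_mul, abs_two]
    linarith
  refine Summable.of_norm_bounded ((uu_summable a).abs.mul_right (3 * ∑' i, |f i|)) fun k => ?_
  rw [Real.norm_eq_abs, abs_mul]
  exact mul_le_mul_of_nonneg_left (hb k) (abs_nonneg _)

lemma PP_const (r : ℝ) (f : ℕ → ℝ) (k : ℕ) : PP (fun i => r * f i) k = r * PP f k := by
  simp only [PP, ← Finset.mul_sum]; ring

lemma lim_twos (a : ℕ) : Tendsto (fun N => 2 * ∑ k ∈ Finset.range N, uu a k) atTop
    (𝓝 (zetaStar (List.replicate (a+1) 2))) := by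
  have h := MRep_lim (t := List.replicate (a+1) 2) (A := fun k => 2 * uu a k) (by
    refine MRep_congr (MRep_twos MRep_nil (a+1)) (by simp) fun k => ?_
    simp only [uu]; ring) ((uu_summable a).mul_left 2)
  simpa only [Finset.mul_sum] using h

lemma lim_main (a b c : ℕ) :
    Tendsto (fun N => 2 * ∑ k ∈ Finset.range N, uu c k * PP (fun j => uu b j * PP (uu a) j) k) atTop
    (𝓝 (zetaStar (List.replicate (a+1) 2 ++ [1] ++ List.replicate b 2 ++ [3]
      ++ List.replicate c 2))) := by
  have h := MRep_lim (t := List.replicate (a+1) 2 ++ [1] ++ List.replicate b 2 ++ [3]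
      ++ List.replicate c 2)
    (A := fun k => 2 * (uu c k * PP (fun j => uu b j * PP (uu a) j) k)) (by
    have h0 : MRep (List.replicate (a+1) 2) (fun k => 2 * uu a k) := by
      refine MRep_congr (MRep_twos MRep_nil (a+1)) (by simp) fun k => ?_
      simp only [uu]; ring
    refine MRep_congr (MRep_twos (MRep_three (MRep_twos (MRep_one h0) b)) c) rfl fun k => ?_
    have : (fun i : ℕ => (-1:ℝ)^i * ((i+1:ℝ)⁻¹ * (((i+1:ℝ)^(2*b))⁻¹ *
        ((i+1:ℝ)⁻¹ * PP (fun k => 2 * uu a k) i))))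
        = fun i => 2 * (uu b i * PP (uu a) i) := by
      funext i
      rw [PP_const]
      simp only [uu]
      have : (i+1:ℝ) ≠ 0 := by positivity
      field_simp
      ring
    rw [this, PP_const]
    simp only [uu]
    have : (k+1:ℝ) ≠ 0 := by positivity
    field_simp
    ring) ((uPP_summable c (uPP_summable b (uu_summable a))).mul_left 2)
  simpa only [Finset.mul_sum] using h

noncomputable def WW (x y z : ℕ → ℝ) (N : ℕ) : ℝ :=
  ∑ k ∈ Finset.range N, z k * PP (fun j => y j * PP x j) k

lemma pair (x y : ℕ → ℝ) (N : ℕ) :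
    (∑ j ∈ Finset.range N, y j * PP x j) + ∑ j ∈ Finset.range N, x j * PP y j
      = 2 * ((∑ j ∈ Finset.range N, x j) * ∑ j ∈ Finset.range N, y j) := by
  induction N with
  | zero => simp
  | succ N ih =>
    simp only [Finset.sum_range_succ]
    simp only [PP] at ih ⊢
    linear_combination ih

lemma sym (x y z : ℕ → ℝ) (N : ℕ) :
    WW x y z N + WW y x z N + WW x z y N + WW z x y N + WW y z x N + WW z y x N
      = 4 * ((∑ j ∈ Finset.range N, x j) * (∑ j ∈ Finset.range N, y j)
          * ∑ j ∈ Finset.range N, z j) + 2 * ∑ j ∈ Finset.range N, x j * y j * z j := by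
  induction N with
  | zero => simp [WW]
  | succ N ih =>
    have h1 := pair x y N
    have h2 := pair x z N
    have h3 := pair y z N
    simp only [WW, Finset.sum_range_succ] at ih ⊢
    have e : ∀ f : ℕ → ℝ, PP f N = f N + 2 * ∑ k ∈ Finset.range N, f k := fun _ => rfl
    rw [e (fun j => y j * PP x j), e (fun j => x j * PP y j), e (fun j => z j * PP x j),
      e (fun j => x j * PP z j), e (fun j => y j * PP z j), e (fun j => z j * PP y j)]
    rw [e x, e y, e z]
    linear_combination ih + 2 * z N * h1 + 2 * y N * h2 + 2 * x N * h3

theorem mzsv_cyclic_insertion_depth_three (a b c : ℕ) :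
    (∑ σ : Equiv.Perm (Fin 3),
      zetaStar (List.replicate ((![a, b, c] (σ 0)) + 1) 2 ++ [1] ++
        List.replicate (![a, b, c] (σ 1)) 2 ++ [3] ++
        List.replicate (![a, b, c] (σ 2)) 2))
    = zetaStar (List.replicate (a + 1) 2) * zetaStar (List.replicate (b + 1) 2) *
        zetaStar (List.replicate (c + 1) 2) +
      2 * zetaStar (List.replicate (a + b + c + 3) 2) := by
  have hperm : ∀ g : Fin 3 → Fin 3 → Fin 3 → ℝ,
      ∑ σ : Equiv.Perm (Fin 3), g (σ 0) (σ 1) (σ 2)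
      = g 0 1 2 + g 1 0 2 + g 0 2 1 + g 2 0 1 + g 1 2 0 + g 2 1 0 := by
    intro g
    have hu : (Finset.univ : Finset (Equiv.Perm (Fin 3))) =
        {1, Equiv.swap 0 1, Equiv.swap 1 2, Equiv.swap 0 1 * Equiv.swap 0 2,
          Equiv.swap 0 1 * Equiv.swap 1 2, Equiv.swap 0 2} := by decide
    have s1 : ∀ i j k : Fin 3, ∀ σ : Equiv.Perm (Fin 3), σ 0 = i ∧ σ 1 = j ∧ σ 2 = k →
        g (σ 0) (σ 1) (σ 2) = g i j k := by
      rintro i j k σ ⟨rfl, rfl, rfl⟩; rfl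
    rw [hu, Finset.sum_insert (by decide), Finset.sum_insert (by decide),
      Finset.sum_insert (by decide), Finset.sum_insert (by decide),
      Finset.sum_insert (by decide), Finset.sum_singleton,
      s1 0 1 2 1 (by decide), s1 1 0 2 (Equiv.swap 0 1) (by decide),
      s1 0 2 1 (Equiv.swap 1 2) (by decide),
      s1 2 0 1 (Equiv.swap 0 1 * Equiv.swap 0 2) (by decide),
      s1 1 2 0 (Equiv.swap 0 1 * Equiv.swap 1 2) (by decide),
      s1 2 1 0 (Equiv.swap 0 2) (by decide)]
    ring
  rw [hperm (fun i j k => zetaStar (List.replicate ((![a, b, c] i) + 1) 2 ++ [1] ++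
        List.replicate (![a, b, c] j) 2 ++ [3] ++ List.replicate (![a, b, c] k) 2))]
  have hL := (((((lim_main a b c).add (lim_main b a c)).add (lim_main a c b)).add
    (lim_main c a b)).add (lim_main b c a)).add (lim_main c b a)
  have hR := (((lim_twos a).mul (lim_twos b)).mul (lim_twos c)).add
    ((lim_twos (a+b+c+2)).const_mul 2)
  refine tendsto_nhds_unique hL (hR.congr fun N => ?_)
  have h := sym (uu a) (uu b) (uu c) N
  have e : ∀ j, uu a j * uu b j * uu c j = uu (a+b+c+2) j := by
    intro j
    have : ((-1:ℝ)^j)^2 = 1 := by rw [← pow_mul, mul_comm, pow_mul]; simp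
    have hj : (j+1:ℝ) ≠ 0 := by positivity
    simp only [uu]
    have h2 : ((j+1:ℝ)^(2*(a+b+c+2+1)))⁻¹ = ((j+1:ℝ)^(2*(a+1)))⁻¹ * ((j+1:ℝ)^(2*(b+1)))⁻¹
        * ((j+1:ℝ)^(2*(c+1)))⁻¹ := by
      rw [← mul_inv, ← mul_inv, ← pow_add, ← pow_add]
      congr 2; ring
    rw [h2]
    linear_combination (-1)^j * (((j+1:ℝ)^(2*(a+1)))⁻¹ * ((j+1:ℝ)^(2*(b+1)))⁻¹
        * ((j+1:ℝ)^(2*(c+1)))⁻¹) * this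
  simp only [e, WW] at h
  linear_combination -2 * h
end

section
/- For every integer n ≥ 1, ζ*({2}^n) = −2·Σ_{m=1}^∞ (−1)^m/m^{2n} = 2·(1 − 2^{1−2n})·ζ(2n). -/
open Finset

/-- Coefficients `N!^2 / ((N-k)! (N+k)!)`. -/
noncomputable def zcc (N k : ℕ) : ℝ := ∏ i ∈ range k, (((N : ℝ) - i) / ((N : ℝ) + i + 1))

lemma zcc_succ (N k : ℕ) : zcc N (k + 1) = zcc N k * (((N : ℝ) - k) / ((N : ℝ) + k + 1)) := by
  rw [zcc, prod_range_succ, zcc]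

lemma zcc_zero (N k : ℕ) (h : N < k) : zcc N k = 0 := by
  unfold zcc
  exact prod_eq_zero (mem_range.2 h) (by simp)

lemma zcc_rec (N k : ℕ) :
    zcc (N + 1) k * (((N : ℝ) + 1 - k) * ((N : ℝ) + 1 + k)) = ((N : ℝ) + 1) ^ 2 * zcc N k := by
  induction k with
  | zero => simp [zcc]; ring
  | succ k ih =>
    rw [zcc_succ, zcc_succ]
    have h1 : (N : ℝ) + k + 1 ≠ 0 := by positivity
    have h2 : (N : ℝ) + 1 + k + 1 ≠ 0 := by positivity
    push_cast
    field_simp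
    linear_combination ((N : ℝ) - k) * ((N : ℝ) + 1 + k + 1) * ih

lemma zcc_bound (N k : ℕ) : 0 ≤ zcc N k ∧ zcc N k ≤ 1 := by
  rcases lt_or_ge N k with h | h
  · rw [zcc_zero N k h]; simp
  · have hi : ∀ i ∈ range k, (i : ℝ) ≤ N := fun i hi => by
      have := mem_range.1 hi
      exact_mod_cast (by omega : i ≤ N)
    constructor
    · exact prod_nonneg fun i hh => div_nonneg (by linarith [hi i hh]) (by positivity)
    · refine prod_le_one (fun i hh => div_nonneg (by linarith [hi i hh]) (by positivity))
        fun i hh => ?_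
      rw [div_le_one (by positivity)]
      have : (0 : ℝ) ≤ i := by positivity
      linarith

lemma zcc_tendsto (k : ℕ) : Filter.Tendsto (fun N => zcc N k) Filter.atTop (nhds 1) := by
  have : Filter.Tendsto (fun N => zcc N k) Filter.atTop (nhds (∏ i ∈ range k, (1 : ℝ))) := by
    unfold zcc
    refine tendsto_finsetProd _ fun i _ => ?_
    have h : Filter.Tendsto (fun N : ℕ => 1 - (2 * (i : ℝ) + 1) / ((N : ℝ) + (i + 1)))
        Filter.atTop (nhds (1 - 0)) := by
      refine tendsto_const_nhds.sub ?_
      refine Filter.Tendsto.const_div_atTop ?_ _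
      exact Filter.tendsto_atTop_add_const_right _ _ tendsto_natCast_atTop_atTop
    rw [sub_zero] at h
    refine h.congr fun N => ?_
    have h1 : (N : ℝ) + i + 1 ≠ 0 := by positivity
    have h2 : (N : ℝ) + (i + 1) ≠ 0 := by positivity
    field_simp
    ring
  simpa using this

noncomputable def zA (n N : ℕ) : ℝ :=
  2 * ∑ k ∈ range N, (-1 : ℝ) ^ k * zcc N (k + 1) / ((k : ℝ) + 1) ^ (2 * n)

lemma zA_zero (N : ℕ) : zA 0 (N + 1) = 1 := by
  have key : ∀ K, ∑ k ∈ range K, (-1 : ℝ) ^ k * zcc (N + 1) (k + 1)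
      = 1 / 2 - (-1) ^ K * zcc (N + 1) K * (((N : ℝ) + 1) - K) / (2 * ((N : ℝ) + 1)) := by
    intro K
    have h0 : (N : ℝ) + 1 ≠ 0 := by positivity
    induction K with
    | zero => simp [zcc]; field_simp; norm_num
    | succ K ih =>
      rw [sum_range_succ, ih, zcc_succ]
      have h1 : (N : ℝ) + 1 + K + 1 ≠ 0 := by positivity
      push_cast
      field_simp
      ring
  have := key (N + 1)
  simp [zA, this]

lemma zA_rec (n N : ℕ) :
    zA (n + 1) (N + 1) = zA (n + 1) N + zA n (N + 1) * (((N + 1 : ℕ) : ℝ) ^ 2)⁻¹ := by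
  have h : zA (n + 1) N =
      2 * ∑ k ∈ range (N + 1), (-1 : ℝ) ^ k * zcc N (k + 1) / ((k : ℝ) + 1) ^ (2 * (n + 1)) := by
    rw [sum_range_succ, zcc_zero N (N + 1) (by omega)]
    simp [zA]
  rw [h, zA, zA, mul_assoc, sum_mul, ← mul_add, ← sum_add_distrib]
  congr 1
  refine sum_congr rfl fun k _ => ?_
  have hr := zcc_rec N (k + 1)
  have h1 : (N : ℝ) + 1 ≠ 0 := by positivity
  have h2 : (k : ℝ) + 1 ≠ 0 := by positivity
  have h3 : zcc N (k + 1) = zcc (N + 1) (k + 1) *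
      (((N : ℝ) + 1 - (k + 1)) * ((N : ℝ) + 1 + (k + 1))) / ((N : ℝ) + 1) ^ 2 := by
    field_simp
    push_cast at hr
    linarith
  rw [h3, mul_add, pow_add]
  push_cast
  field_simp
  ring

lemma zA_sum (n N : ℕ) :
    zA (n + 1) N = ∑ j ∈ range N, zA n (j + 1) * (((j + 1 : ℕ) : ℝ) ^ 2)⁻¹ := by
  induction N with
  | zero => simp [zA]
  | succ N ih => rw [sum_range_succ, ← ih, zA_rec]

lemma zA_nonneg (n N : ℕ) : 0 ≤ zA n (N + 1) := by
  induction n generalizing N with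
  | zero => simp [zA_zero]
  | succ n ih =>
    rw [zA_sum]
    exact sum_nonneg fun j _ => mul_nonneg (ih j) (by positivity)

lemma zsummable (n : ℕ) : Summable fun k : ℕ => (1 : ℝ) / ((k : ℝ) + 1) ^ (2 * (n + 1)) := by
  have h := (Real.summable_one_div_nat_pow (p := 2 * (n + 1))).2 (by omega)
  have := (summable_nat_add_iff 1).2 h
  simpa using this

lemma zA_tendsto (n : ℕ) : Filter.Tendsto (fun N => zA (n + 1) N) Filter.atTop
    (nhds (2 * ∑' k : ℕ, (-1 : ℝ) ^ k / ((k : ℝ) + 1) ^ (2 * (n + 1)))) := by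
  have e : (fun N => zA (n + 1) N) = fun N =>
      2 * ∑' k : ℕ, (-1 : ℝ) ^ k * zcc N (k + 1) / ((k : ℝ) + 1) ^ (2 * (n + 1)) := by
    funext N
    rw [zA, tsum_eq_sum]
    intro k hk
    rw [zcc_zero N (k + 1) (by simp at hk; omega)]
    simp
  rw [e]
  refine Filter.Tendsto.const_mul _ ?_
  refine tendsto_tsum_of_dominated_convergence (zsummable n) (fun k => ?_) ?_
  · have := ((zcc_tendsto (k + 1)).const_mul ((-1 : ℝ) ^ k)).div_const
      (((k : ℝ) + 1) ^ (2 * (n + 1)))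
    simpa using this
  · refine Filter.Eventually.of_forall fun N k => ?_
    rw [norm_div, norm_mul]
    have hb := zcc_bound N (k + 1)
    have h1 : ‖((k : ℝ) + 1) ^ (2 * (n + 1))‖ = ((k : ℝ) + 1) ^ (2 * (n + 1)) :=
      Real.norm_of_nonneg (by positivity)
    rw [h1, Real.norm_of_nonneg hb.1]
    have h2 : ‖(-1 : ℝ) ^ k‖ = 1 := by simp
    rw [h2, one_mul]
    gcongr
    exact hb.2

lemma zhasSum (n : ℕ) : HasSum (fun j : ℕ => zA n (j + 1) * (((j + 1 : ℕ) : ℝ) ^ 2)⁻¹)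
    (2 * ∑' k : ℕ, (-1 : ℝ) ^ k / ((k : ℝ) + 1) ^ (2 * (n + 1))) := by
  rw [hasSum_iff_tendsto_nat_of_nonneg
    (fun j => mul_nonneg (zA_nonneg n j) (by positivity))]
  simpa only [← zA_sum] using zA_tendsto n

noncomputable def zw (j : ℕ) : ENNReal := ENNReal.ofReal (((j : ℝ) ^ 2)⁻¹)

open Classical in
noncomputable def zW (n : ℕ) (N : ℕ+) : ENNReal :=
  ∑' f : Fin n → ℕ+, if Monotone f ∧ ∀ i, f i ≤ N then ∏ i, zw (f i) else 0

lemma zmono_snoc (n : ℕ) (g : Fin n → ℕ+) (j : ℕ+) :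
    Monotone (Fin.snoc (α := fun _ => ℕ+) g j : Fin (n + 1) → ℕ+)
      ↔ Monotone g ∧ ∀ i, g i ≤ j := by
  constructor
  · intro h
    refine ⟨fun a b hab => ?_, fun i => ?_⟩
    · have := h (Fin.castSucc_le_castSucc_iff.2 hab)
      simpa using this
    · have := h (Fin.le_last (Fin.castSucc i))
      simpa using this
  · rintro ⟨h1, h2⟩ a b
    induction a using Fin.lastCases with
    | last =>
      intro hab
      have : b = Fin.last n := Fin.last_le_iff.1 hab
      rw [this]
    | cast a =>
      induction b using Fin.lastCases with
      | last => intro _; simpa using h2 a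
      | cast b => intro hab; simpa using h1 (Fin.castSucc_le_castSucc_iff.1 hab)

open Classical in
lemma zT_succ (n : ℕ) :
    (∑' f : Fin (n + 1) → ℕ+, if Monotone f then ∏ i, zw (f i) else 0)
      = ∑' j : ℕ+, zW n j * zw j := by
  rw [← (Fin.snocEquiv (fun _ => ℕ+)).tsum_eq, ENNReal.summable.tsum_prod' (fun _ => ENNReal.summable)]
  refine tsum_congr fun j => ?_
  rw [zW, ← ENNReal.tsum_mul_right]
  refine tsum_congr fun g => ?_
  have hm : Monotone ((Fin.snocEquiv fun _ => ℕ+) (j, g)) ↔ Monotone g ∧ ∀ i, g i ≤ j :=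
    zmono_snoc n g j
  simp only [hm, Fin.snocEquiv_apply, Fin.prod_univ_castSucc, Fin.snoc_castSucc,
    Fin.snoc_last]
  split_ifs <;> simp

open Classical in
lemma zW_succ (n : ℕ) (N : ℕ+) :
    zW (n + 1) N = ∑' j : ℕ+, if j ≤ N then zW n j * zw j else 0 := by
  rw [zW, ← (Fin.snocEquiv (fun _ => ℕ+)).tsum_eq, ENNReal.summable.tsum_prod' (fun _ => ENNReal.summable)]
  refine tsum_congr fun j => ?_
  rw [zW, ← ENNReal.tsum_mul_right]
  by_cases hj : j ≤ N
  · rw [if_pos hj]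
    refine tsum_congr fun g => ?_
    have hm : Monotone ((Fin.snocEquiv fun _ => ℕ+) (j, g)) ↔ Monotone g ∧ ∀ i, g i ≤ j :=
      zmono_snoc n g j
    simp only [hm, Fin.snocEquiv_apply, Fin.prod_univ_castSucc, Fin.snoc_castSucc,
      Fin.snoc_last, Fin.forall_fin_succ', hj, and_true]
    have : ((Monotone g ∧ ∀ i, g i ≤ j) ∧ ∀ i, g i ≤ N) ↔ (Monotone g ∧ ∀ i, g i ≤ j) :=
      ⟨fun h => h.1, fun h => ⟨h, fun i => (h.2 i).trans hj⟩⟩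
    simp only [this]
    split_ifs <;> simp
  · rw [if_neg hj]
    simp [Fin.forall_fin_succ', hj]

lemma zW_eq (n : ℕ) (N : ℕ+) : zW n N = ENNReal.ofReal (zA n N) := by
  induction n generalizing N with
  | zero =>
    obtain ⟨M, hM⟩ : ∃ M, (N : ℕ) = M + 1 := ⟨N - 1, by have := N.pos; omega⟩
    rw [hM, zA_zero, zW, tsum_eq_single (fun i => i.elim0)]
    · simp [Subsingleton.monotone]
    · intro b hb; exact absurd (Subsingleton.elim _ _) hb
  | succ n ih =>
    rw [zW_succ]
    have := tsum_pnat_eq_tsum_succ (f := fun j : ℕ => if j ≤ (N : ℕ) then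
      ENNReal.ofReal (zA n j) * zw j else 0)
    simp only [ih, ← PNat.coe_le_coe]
    rw [this, tsum_eq_sum (s := range N), zA_sum, ENNReal.ofReal_sum_of_nonneg]
    · refine sum_congr rfl fun j hj => ?_
      rw [if_pos (by simpa using hj), zw, ← ENNReal.ofReal_mul (zA_nonneg n j)]
    · exact fun j _ => mul_nonneg (zA_nonneg n j) (by positivity)
    · intro j hj
      rw [if_neg (by simpa using hj)]

lemma zstar_eq (n : ℕ) :
    (∑' f : {f : Fin (n + 1) → ℕ+ // Monotone f}, ∏ i, (((f.1 i : ℕ) : ℝ) ^ 2)⁻¹)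
      = 2 * ∑' k : ℕ, (-1 : ℝ) ^ k / ((k : ℝ) + 1) ^ (2 * (n + 1)) := by
  classical
  have h1 : (∑' f : Fin (n + 1) → ℕ+, if Monotone f then ∏ i, zw (f i) else 0)
      = ENNReal.ofReal (2 * ∑' k : ℕ, (-1 : ℝ) ^ k / ((k : ℝ) + 1) ^ (2 * (n + 1))) := by
    rw [zT_succ]
    simp only [zW_eq]
    rw [tsum_pnat_eq_tsum_succ (f := fun j : ℕ => ENNReal.ofReal (zA n j) * zw j),
      ← (zhasSum n).tsum_eq, ENNReal.ofReal_tsum_of_nonneg _ (zhasSum n).summable]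
    · exact tsum_congr fun j => by rw [zw, ← ENNReal.ofReal_mul (zA_nonneg n j)]
    · exact fun j => mul_nonneg (zA_nonneg n j) (by positivity)
  have h2 : (∑' f : {f : Fin (n + 1) → ℕ+ // Monotone f}, ∏ i, zw (f.1 i))
      = ∑' f : Fin (n + 1) → ℕ+, if Monotone f then ∏ i, zw (f i) else 0 := by
    have := tsum_subtype {f : Fin (n + 1) → ℕ+ | Monotone f} (fun f => ∏ i, zw (f i))
    simp only [Set.indicator, Set.mem_ofPred_eq] at this
    exact this
  have h3 : 0 ≤ 2 * ∑' k : ℕ, (-1 : ℝ) ^ k / ((k : ℝ) + 1) ^ (2 * (n + 1)) :=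
    (zhasSum n).nonneg fun j => mul_nonneg (zA_nonneg n j) (by positivity)
  rw [← ENNReal.toReal_ofReal h3, ← h1, ← h2, ENNReal.tsum_toReal_eq]
  · refine tsum_congr fun f => ?_
    rw [ENNReal.toReal_prod]
    refine prod_congr rfl fun i _ => ?_
    rw [zw, ENNReal.toReal_ofReal (by positivity)]
  · intro f
    exact ENNReal.prod_ne_top fun i _ => ENNReal.ofReal_ne_top

lemma zstar_repl (n : ℕ) : zetaStar (List.replicate (n + 1) 2)
    = 2 * ∑' k : ℕ, (-1 : ℝ) ^ k / ((k : ℝ) + 1) ^ (2 * (n + 1)) := by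
  rw [← zstar_eq, zetaStar]
  simp only [List.get_eq_getElem, List.getElem_replicate]
  have : ∀ m, m = n + 1 →
    (∑' f : {f : Fin m → ℕ+ // Monotone f}, ∏ i, (((f.1 i : ℕ) : ℝ) ^ 2)⁻¹) =
    ∑' f : {f : Fin (n + 1) → ℕ+ // Monotone f}, ∏ i, (((f.1 i : ℕ) : ℝ) ^ 2)⁻¹ := by
    rintro m rfl; rfl
  exact this _ (by simp)

lemma zalt (n : ℕ) : 2 * ∑' k : ℕ, (-1 : ℝ) ^ k / ((k : ℝ) + 1) ^ (2 * (n + 1))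
    = 2 * (1 - (2 : ℝ) ^ (1 - 2 * ((n + 1 : ℕ) : ℤ)))
      * ∑' k : ℕ, (((k : ℝ) + 1) ^ (2 * (n + 1)))⁻¹ := by
  have hs := zsummable n
  simp only [one_div] at hs
  have hp : (2 : ℝ) ^ (1 - 2 * ((n + 1 : ℕ) : ℤ)) = 2 * ((2 : ℝ) ^ (2 * (n + 1)))⁻¹ := by
    rw [zpow_sub₀ (by norm_num), zpow_one, div_eq_mul_inv]
    norm_cast
  rw [hp]
  generalize 2 * (n + 1) = p at hs ⊢
  have hinj : Function.Injective fun k : ℕ => 2 * k := fun a b h => by simpa using h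
  have hinj' : Function.Injective fun k : ℕ => 2 * k + 1 := fun a b h => by simpa using h
  have he : Summable fun k : ℕ => ((((2 * k : ℕ) : ℝ) + 1) ^ p)⁻¹ :=
    hs.comp_injective hinj
  have ho : Summable fun k : ℕ => ((((2 * k + 1 : ℕ) : ℝ) + 1) ^ p)⁻¹ :=
    hs.comp_injective hinj'
  have hz := tsum_even_add_odd (f := fun k : ℕ => (((k : ℝ) + 1) ^ p)⁻¹) he ho
  have he2 : Summable fun k : ℕ =>
      (-1 : ℝ) ^ (2 * k) / (((2 * k : ℕ) : ℝ) + 1) ^ (p) := by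
    refine he.congr fun k => ?_
    simp [pow_mul, div_eq_mul_inv]
  have ho2e : (fun k : ℕ => (-1 : ℝ) ^ (2 * k + 1) / (((2 * k + 1 : ℕ) : ℝ) + 1) ^ (p))
      = fun k : ℕ => -((2 : ℝ) ^ (p))⁻¹ * (((k : ℝ) + 1) ^ (p))⁻¹ := by
    funext k
    have : ((2 * k + 1 : ℕ) : ℝ) + 1 = 2 * ((k : ℝ) + 1) := by push_cast; ring
    rw [this, mul_pow, pow_succ, pow_mul, div_eq_mul_inv, mul_inv]
    norm_num
  have hoe : (fun k : ℕ => ((((2 * k + 1 : ℕ) : ℝ) + 1) ^ (p))⁻¹)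
      = fun k : ℕ => ((2 : ℝ) ^ (p))⁻¹ * (((k : ℝ) + 1) ^ (p))⁻¹ := by
    funext k
    have : ((2 * k + 1 : ℕ) : ℝ) + 1 = 2 * ((k : ℝ) + 1) := by push_cast; ring
    rw [this, mul_pow, mul_inv]
  have hee : (fun k : ℕ => (-1 : ℝ) ^ (2 * k) / (((2 * k : ℕ) : ℝ) + 1) ^ (p))
      = fun k : ℕ => ((((2 * k : ℕ) : ℝ) + 1) ^ (p))⁻¹ := by
    funext k
    simp [pow_mul, div_eq_mul_inv]
  have hb := tsum_even_add_odd (f := fun k : ℕ => (-1 : ℝ) ^ k / ((k : ℝ) + 1) ^ (p))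
    he2 (by rw [ho2e]; exact hs.mul_left _)
  rw [ho2e, hee, tsum_mul_left] at hb
  rw [hoe, tsum_mul_left] at hz
  linear_combination (-2) * hb + 2 * hz

theorem zlobin_evaluation (n : ℕ) (hn : 1 ≤ n) :
    zetaStar (List.replicate n 2)
      = -2 * ∑' m : ℕ+, (-1 : ℝ) ^ (m : ℕ) / (m : ℝ) ^ (2 * n) ∧
    zetaStar (List.replicate n 2)
      = 2 * (1 - (2 : ℝ) ^ (1 - 2 * (n : ℤ))) * ∑' m : ℕ+, ((m : ℝ) ^ (2 * n))⁻¹ := by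
  obtain ⟨n, rfl⟩ : ∃ m, n = m + 1 := ⟨n - 1, by omega⟩
  have h1 := tsum_pnat_eq_tsum_succ (f := fun m : ℕ => (-1 : ℝ) ^ m / (m : ℝ) ^ (2 * (n + 1)))
  have h2 := tsum_pnat_eq_tsum_succ (f := fun m : ℕ => ((m : ℝ) ^ (2 * (n + 1)))⁻¹)
  rw [h1, h2, zstar_repl]
  refine ⟨?_, ?_⟩
  · rw [← tsum_mul_left, ← tsum_mul_left]
    refine tsum_congr fun k => ?_
    push_cast
    ring
  · rw [zalt]
    push_cast
    rfl
end

section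
/- Let s: ℕ → ℝ (or any commutative monoid-valued weights) and fix n. Then Σ_{σ ∈ S_n} Σ_{compositions c of n into t parts} F applied to the blocks of (s_{σ(1)},...,s_{σ(n)}) determined by c, for any symmetric-in-blocks function, can be rewritten as Σ over unordered set partitions q of {1,...,n} of (∏_i (#q_i)!)·(#q)!·F(block sums of q)/(symmetrization); concretely: Σ_{σ∈S_n} Σ_{c} G(block sums of σ·s under c) = Σ_{q∈Part(n)} (∏_i (#q_i)!) Σ_{τ∈S_{#q}} G(sum over q_{τ(1)},...,sum over q_{τ(#q)}), for every function G on finite sequences of reals. -/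
open Finset

def SymmValid {n : ℕ} (L : List (Finset (Fin n))) : Prop :=
  (∀ x ∈ L, x.Nonempty) ∧ L.Pairwise Disjoint ∧ ∀ j, ∃ x ∈ L, j ∈ x

def symmX (n : ℕ) : Type :=
  Σ c : Composition n, {f : Fin n → Fin c.length // ∀ m, #{j | f j = m} = c.blocksFun m}

def symmLX {n : ℕ} (x : symmX n) : List (Finset (Fin n)) :=
  List.ofFn fun m => ({j | x.2.1 j = m} : Finset (Fin n))

def symmY (n : ℕ) : Type :=
  Σ q : Finpartition (Finset.univ : Finset (Fin n)), Fin q.parts.card ≃ {p // p ∈ q.parts}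

def symmLY {n : ℕ} (x : symmY n) : List (Finset (Fin n)) :=
  List.ofFn fun m => (x.2 m : Finset (Fin n))

lemma symmLX_blocks {n : ℕ} (x : symmX n) : (symmLX x).map Finset.card = x.1.blocks := by
  rw [symmLX, List.map_ofFn, ← Composition.ofFn_blocksFun]
  congr 1
  funext m
  exact x.2.2 m

lemma symmLX_inj (n : ℕ) : Function.Injective (symmLX (n := n)) := by
  rintro x y h
  have h1 : x.1 = y.1 := by
    apply Composition.ext
    rw [← symmLX_blocks, ← symmLX_blocks, h]
  obtain ⟨c, f, hf⟩ := x
  obtain ⟨c', g, hg⟩ := y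
  dsimp only at h1
  subst h1
  have h2 := List.ofFn_injective h
  congr 2
  funext j
  have h3 := congrFun h2 (f j)
  dsimp only at h3
  have : j ∈ ({i | g i = f j} : Finset (Fin n)) := by rw [← h3]; simp
  simpa using (by simpa using this : g j = f j).symm

lemma symmLX_valid {n : ℕ} (x : symmX n) : SymmValid (symmLX x) := by
  refine ⟨?_, ?_, ?_⟩
  · intro p hp
    obtain ⟨m, rfl⟩ := (List.mem_ofFn' _ _).1 hp
    rw [← Finset.card_pos]
    exact lt_of_lt_of_eq (x.1.one_le_blocksFun m) (x.2.2 m).symm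
  · rw [symmLX, List.pairwise_ofFn]
    intro i j hij
    rw [Finset.disjoint_left]
    intro a ha hb
    simp only [mem_filter, mem_univ, true_and] at ha hb
    exact hij.ne (ha.symm.trans hb)
  · intro j
    exact ⟨_, (List.mem_ofFn' _ _).2 ⟨x.2.1 j, rfl⟩, by simp⟩

lemma symmValid_uniq {n : ℕ} {L : List (Finset (Fin n))} (h : SymmValid L) (i j : ℕ)
    (hi : i < L.length) (hj : j < L.length) (a : Fin n) (ha : a ∈ L[i]) (hb : a ∈ L[j]) :
    i = j := by
  have := List.pairwise_iff_getElem.1 h.2.1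
  rcases lt_trichotomy i j with hij | hij | hij
  · exact absurd hb (Finset.disjoint_left.1 (this i j hi hj hij) ha)
  · exact hij
  · exact absurd ha (Finset.disjoint_left.1 (this j i hj hi hij) hb)

lemma symmValid_nodup {n : ℕ} {L : List (Finset (Fin n))} (h : SymmValid L) : L.Nodup := by
  rw [List.nodup_iff_injective_get]
  intro i j hij
  obtain ⟨a, ha⟩ := h.1 (L.get i) (List.get_mem _ _)
  exact Fin.ext (symmValid_uniq h i j i.2 j.2 a ha (by rw [hij] at ha; exact ha))

lemma symmLX_surj {n : ℕ} {L : List (Finset (Fin n))} (h : SymmValid L) :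
    ∃ x : symmX n, symmLX x = L := by
  have h0 : ∀ j, ∃ m : Fin L.length, j ∈ L[m] := by
    intro j
    obtain ⟨x, hx, hj⟩ := h.2.2 j
    obtain ⟨m, rfl⟩ := List.mem_iff_get.1 hx
    exact ⟨m, hj⟩
  choose f hf using h0
  have hfib : ∀ m : Fin L.length, ({j | f j = m} : Finset (Fin n)) = L[m] := by
    intro m
    ext j
    simp only [mem_filter, mem_univ, true_and]
    constructor
    · rintro rfl; exact hf j
    · intro hj
      exact Fin.ext (symmValid_uniq h _ _ (f j).2 m.2 j (hf j) hj)
  have hsum : (L.map Finset.card).sum = n := by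
    have h1 : L.map Finset.card = List.ofFn fun m : Fin L.length => #{j | f j = m} := by
      apply List.ext_getElem (by simp)
      intro i h1 h2
      simp only [List.getElem_map, List.getElem_ofFn]
      rw [hfib]; rfl
    rw [h1, List.sum_ofFn, ← Finset.card_eq_sum_card_fiberwise (fun _ _ => mem_coe.2 (mem_univ _))]
    simp
  have hlen : L.length = (L.map Finset.card).length := by simp
  let c : Composition n := ⟨L.map Finset.card, by
    intro i hi
    obtain ⟨p, hp, rfl⟩ := List.mem_map.1 hi
    exact Finset.card_pos.2 (h.1 p hp), hsum⟩
  have hfib2 : ∀ m : Fin c.length,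
      ({j | Fin.cast hlen (f j) = m} : Finset (Fin n)) = L[(m : ℕ)]'(by
        have := m.2; rw [hlen]; exact this) := by
    intro m
    have := hfib (Fin.cast hlen.symm m)
    refine Eq.trans ?_ this
    ext j
    simp [Fin.ext_iff]
  refine ⟨⟨c, fun j => Fin.cast hlen (f j), ?_⟩, ?_⟩
  · intro m
    rw [hfib2 m]
    simp [c, Composition.blocksFun]
  · apply List.ext_getElem
    · exact (List.length_ofFn).trans hlen.symm
    · intro i h1 h2
      simp only [symmLX, List.getElem_ofFn]
      exact hfib2 ⟨i, lt_of_lt_of_eq h2 hlen⟩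

lemma symmLY_mem {n : ℕ} (x : symmY n) (p) : p ∈ symmLY x ↔ p ∈ x.1.parts := by
  rw [symmLY, List.mem_ofFn']
  constructor
  · rintro ⟨m, rfl⟩; exact (x.2 m).2
  · intro hp; exact ⟨x.2.symm ⟨p, hp⟩, by simp⟩

lemma symmLY_inj (n : ℕ) : Function.Injective (symmLY (n := n)) := by
  rintro x y h
  have h1 : x.1 = y.1 := by
    apply Finpartition.ext
    ext p
    rw [← symmLY_mem, ← symmLY_mem, h]
  obtain ⟨c, f⟩ := x
  obtain ⟨c', g⟩ := y
  dsimp only at h1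
  subst h1
  have h2 := List.ofFn_injective h
  congr 1
  ext1 m
  exact Subtype.ext (congrFun h2 m)

lemma symmLY_valid {n : ℕ} (x : symmY n) : SymmValid (symmLY x) := by
  refine ⟨?_, ?_, ?_⟩
  · intro p hp
    exact x.1.nonempty_of_mem_parts ((symmLY_mem x p).1 hp)
  · rw [symmLY, List.pairwise_ofFn]
    intro i j hij
    apply x.1.disjoint (x.2 i).2 (x.2 j).2
    intro h
    exact hij.ne (x.2.injective (Subtype.ext h))
  · intro j
    exact ⟨x.1.part j, (symmLY_mem x _).2 (x.1.part_mem.2 (mem_univ j)),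
      x.1.mem_part (mem_univ j)⟩

lemma symmLY_surj {n : ℕ} {L : List (Finset (Fin n))} (h : SymmValid L) :
    ∃ x : symmY n, symmLY x = L := by
  have hnd := symmValid_nodup h
  let q : Finpartition (Finset.univ : Finset (Fin n)) :=
    Finpartition.ofExistsUnique L.toFinset (fun _ _ => subset_univ _) (by
      intro a _
      obtain ⟨p, hp, ha⟩ := h.2.2 a
      refine ⟨p, ⟨by simpa using hp, ha⟩, ?_⟩
      rintro p' ⟨hp', ha'⟩
      rw [List.mem_toFinset] at hp'
      obtain ⟨i, rfl⟩ := List.mem_iff_get.1 hp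
      obtain ⟨j, rfl⟩ := List.mem_iff_get.1 hp'
      have := symmValid_uniq h i j i.2 j.2 a ha ha'
      rw [Fin.ext this]) (by
      intro h0
      rw [List.mem_toFinset] at h0
      simpa using h.1 _ h0)
  have hq : q.parts = L.toFinset := rfl
  have hlen : q.parts.card = L.length := by rw [hq, List.toFinset_card_of_nodup hnd]
  let F : Fin q.parts.card → {p // p ∈ q.parts} := fun m =>
    ⟨L.get (Fin.cast hlen m), List.mem_toFinset.2 (List.get_mem _ _)⟩
  have hF : Function.Bijective F := by
    constructor
    · intro a b hab
      have := List.nodup_iff_injective_get.1 hnd (congrArg Subtype.val hab)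
      simpa [Fin.ext_iff] using this
    · rintro ⟨p, hp⟩
      have hp' := hp
      rw [hq, List.mem_toFinset] at hp'
      obtain ⟨i, rfl⟩ := List.mem_iff_get.1 hp'
      exact ⟨Fin.cast hlen.symm i, rfl⟩
  refine ⟨⟨q, Equiv.ofBijective F hF⟩, ?_⟩
  apply List.ext_getElem
  · exact (List.length_ofFn).trans hlen
  · intro i h1 h2
    simp only [symmLY, List.getElem_ofFn]
    rfl

noncomputable def symmXY (n : ℕ) : symmX n ≃ symmY n :=
  (Equiv.ofInjective _ (symmLX_inj n)).trans
    ((Equiv.setCongr (by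
      ext L
      constructor
      · rintro ⟨x, rfl⟩; exact symmLY_surj (symmLX_valid x)
      · rintro ⟨x, rfl⟩; exact symmLX_surj (symmLY_valid x))).trans
      (Equiv.ofInjective _ (symmLY_inj n)).symm)

lemma symmXY_spec (n : ℕ) (x : symmX n) : symmLY (symmXY n x) = symmLX x := by
  simp only [symmXY, Equiv.trans_apply]
  exact Equiv.apply_ofInjective_symm (symmLY_inj n) _

lemma symm_fiber_card {n k : ℕ} (a f : Fin n → Fin k) :
    #{σ : Equiv.Perm (Fin n) | (fun j => a (σ.symm j)) = f} =
      if ∀ m, #{j | f j = m} = #{j | a j = m} then ∏ m, (#{j | f j = m}).factorial else 0 := by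
  split_ifs with h
  · have e : ∀ m, {j // f j = m} ≃ {j // a j = m} := fun m =>
      Fintype.equivOfCardEq (by rw [Fintype.card_subtype, Fintype.card_subtype, h])
    have hτ : ∀ j, a (Equiv.ofFiberEquiv e j) = f j := Equiv.ofFiberEquiv_map e
    generalize (Equiv.ofFiberEquiv e : Equiv.Perm (Fin n)) = τ at hτ
    have := DomMulAct.stabilizer_card f
    simp only [Fintype.card_subtype] at this
    rw [← this]
    refine Finset.card_bij' (fun σ _ => σ.symm.trans τ.symm) (fun g _ => (g.trans τ).symm)
      ?_ ?_ ?_ ?_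
    · intro σ hσ
      simp only [mem_filter, mem_univ, true_and] at hσ ⊢
      funext j
      have h3 := congrFun hσ j
      have h4 := hτ (τ.symm (σ.symm j))
      simp only [Equiv.apply_symm_apply] at h3 h4
      exact h4.symm.trans h3
    · intro g hg
      simp only [mem_filter, mem_univ, true_and] at hg ⊢
      funext j
      simp [hτ, ← congrFun hg j]
    · intro σ _; ext; simp
    · intro σ _; ext; simp
  · rw [Finset.card_eq_zero, Finset.filter_eq_empty_iff]
    rintro σ - rfl
    apply h
    intro m
    apply Finset.card_bij' (fun j _ => σ.symm j) (fun j _ => σ j) <;> simp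

lemma symm_block {n : ℕ} (c : Composition n) (m : Fin c.length) :
    ({j | c.index j = m} : Finset (Fin n)) = univ.map (c.embedding m).toEmbedding := by
  ext j
  have := c.mem_range_embedding_iff' (j := j) (i := m)
  simp only [mem_filter, mem_univ, true_and, mem_map]
  rw [eq_comm, ← this]
  simp

noncomputable def symmW {n : ℕ} (G : List ℝ → ℝ) (s : Fin n → ℝ) (L : List (Finset (Fin n))) : ℝ :=
  (L.map fun p => (Nat.factorial p.card : ℝ)).prod * G (L.map fun p => ∑ j ∈ p, s j)

lemma symm_left {n : ℕ} (G : List ℝ → ℝ) (s : Fin n → ℝ) (c : Composition n) :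
    ∑ σ : Equiv.Perm (Fin n), G (List.ofFn fun m : Fin c.length =>
        ∑ j : Fin (c.blocksFun m), s (σ (c.embedding m j)))
    = ∑ f : {f : Fin n → Fin c.length // ∀ m, #{j | f j = m} = c.blocksFun m},
        symmW G s (symmLX ⟨c, f⟩) := by
  let g : (Fin n → Fin c.length) → ℝ := fun f =>
    G (List.ofFn fun m : Fin c.length => ∑ j ∈ ({j | f j = m} : Finset (Fin n)), s j)
  have h1 : ∀ σ : Equiv.Perm (Fin n), G (List.ofFn fun m : Fin c.length =>
        ∑ j : Fin (c.blocksFun m), s (σ (c.embedding m j))) = g fun j => c.index (σ.symm j) := by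
    intro σ
    simp only [g]
    congr 2
    funext m
    have : ∑ j ∈ ({j | c.index j = m} : Finset (Fin n)), s (σ j) =
      ∑ j : Fin (c.blocksFun m), s (σ (c.embedding m j)) := by
      rw [symm_block, Finset.sum_map]; rfl
    rw [← this]
    apply Finset.sum_equiv σ <;> simp
  have hc : ∀ m, #{j | c.index j = m} = c.blocksFun m := by
    intro m; rw [symm_block]; simp
  rw [Finset.sum_congr rfl (fun σ _ => h1 σ),
    ← Finset.sum_fiberwise' univ (fun σ : Equiv.Perm (Fin n) => fun j => c.index (σ.symm j)) g]
  simp only [Finset.sum_const, symm_fiber_card, hc]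
  have h2 : ∀ f : {f : Fin n → Fin c.length // ∀ m, #{j | f j = m} = c.blocksFun m},
      symmW G s (symmLX ⟨c, f⟩) = (∏ m, ((#{j | f.1 j = m}).factorial : ℝ)) * g f.1 := by
    intro f
    simp only [symmW, symmLX, List.map_ofFn, List.prod_ofFn]
    rfl
  simp only [h2]
  rw [← Finset.sum_subtype (univ.filter fun f : Fin n → Fin c.length =>
      ∀ m, #{j | f j = m} = c.blocksFun m) (by simp)
      (fun f => (∏ m, ((#{j | f j = m}).factorial : ℝ)) * g f), Finset.sum_filter]
  apply Finset.sum_congr rfl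
  intro f _
  split_ifs <;> simp

theorem symmetrize_composition_sum (n : ℕ) (G : List ℝ → ℝ) (s : Fin n → ℝ) :
    ∑ σ : Equiv.Perm (Fin n), ∑ c : Composition n,
      G (List.ofFn fun m : Fin c.length =>
        ∑ j : Fin (c.blocksFun m), s (σ (c.embedding m j)))
    = ∑ q : Finpartition (Finset.univ : Finset (Fin n)),
        (∏ p ∈ q.parts, (Nat.factorial p.card : ℝ)) *
          ∑ e : Fin q.parts.card ≃ {p // p ∈ q.parts},
            G (List.ofFn fun m => ∑ j ∈ (e m : Finset (Fin n)), s j) := by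
  rw [Finset.sum_comm]
  simp only [symm_left]
  have hR : ∀ q : Finpartition (Finset.univ : Finset (Fin n)),
        (∏ p ∈ q.parts, (Nat.factorial p.card : ℝ)) *
          ∑ e : Fin q.parts.card ≃ {p // p ∈ q.parts},
            G (List.ofFn fun m => ∑ j ∈ (e m : Finset (Fin n)), s j)
      = ∑ e : Fin q.parts.card ≃ {p // p ∈ q.parts}, symmW G s (symmLY ⟨q, e⟩) := by
    intro q
    rw [Finset.mul_sum]
    apply Finset.sum_congr rfl
    intro e _
    simp only [symmW, symmLY, List.map_ofFn, List.prod_ofFn]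
    congr 1
    rw [← Finset.prod_coe_sort]
    exact (Equiv.prod_comp e (fun p => (Nat.factorial (p : Finset (Fin n)).card : ℝ))).symm
  simp only [hR]
  let _ : Fintype (symmX n) := inferInstanceAs (Fintype (Σ c : Composition n,
    {f : Fin n → Fin c.length // ∀ m, #{j | f j = m} = c.blocksFun m}))
  let _ : Fintype (symmY n) := inferInstanceAs (Fintype (Σ q : Finpartition
    (Finset.univ : Finset (Fin n)), Fin q.parts.card ≃ {p // p ∈ q.parts}))
  have key : ∑ x : symmX n, symmW G s (symmLX x) = ∑ y : symmY n, symmW G s (symmLY y) :=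
    Fintype.sum_equiv (symmXY n) _ _ fun x => by rw [symmXY_spec]
  exact (Fintype.sum_sigma _).symm.trans (key.trans (Fintype.sum_sigma _))
end
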